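/- Upper bound for the multi-population pressure: with the notation of the multi-population Curie-Weiss model with pair interactions, for all couplings J_{gk} ∈ ℝ and fields h_g ∈ ℝ, limsup_{N→∞} p_N ≤ sup_{m̄∈[−1,1]^p} p_UP(m̄), where p_UP(m̄) = ln 2 − (1/2)·Σ_{i,j=1}^p J_{ij}·m̄_i·m̄_j + Σ_{j=1}^p α_j·ln cosh( Σ_{i=1}^p ((J_{ij}+J_{ji})/(2·α_j))·m̄_i + h_j/α_j ). -/

import Mathlib

open Filter

noncomputable section

/-- The value of a spin encoded by a Boolean: `+1` or `-1`. -/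
def spin (b : Bool) : ℝ := if b then 1 else -1

/-- The spin observable at site `i` in a system of `N` spins (with a junk value `0`
when `i ≥ N`). -/
def spinAt (N i : ℕ) (σ : Fin N → Bool) : ℝ :=
  if hi : i < N then spin (σ ⟨i, hi⟩) else 0

/-- Group magnetization of group `g` for the partition `P`. -/
def groupMag {p : ℕ} (P : ℕ → Fin p → Finset ℕ) (N : ℕ) (g : Fin p)
    (σ : Fin N → Bool) : ℝ :=
  (∑ i ∈ P N g, spinAt N i σ) / ((P N g).card : ℝ)

/-- Hamiltonian of the multi-population Curie-Weiss model with pair interactions. -/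
def hamPair {p : ℕ} (J : Fin p → Fin p → ℝ) (h : Fin p → ℝ)
    (P : ℕ → Fin p → Finset ℕ) (N : ℕ) (σ : Fin N → Bool) : ℝ :=
  -(N * (1 / 2 * ∑ g, ∑ k, J g k * groupMag P N g σ * groupMag P N k σ
      + ∑ g, h g * groupMag P N g σ))

/-- Pressure per particle of the multi-population model. -/
def pressurePair {p : ℕ} (J : Fin p → Fin p → ℝ) (h : Fin p → ℝ)
    (P : ℕ → Fin p → Finset ℕ) (N : ℕ) : ℝ :=
  Real.log (∑ σ : Fin N → Bool, Real.exp (-hamPair J h P N σ)) / N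

/-- The upper-bound variational functional `p_UP` of the multi-population model. -/
def pUP {p : ℕ} (α : Fin p → ℝ) (J : Fin p → Fin p → ℝ) (h : Fin p → ℝ)
    (m : Fin p → ℝ) : ℝ :=
  Real.log 2 - 1 / 2 * ∑ i, ∑ j, J i j * m i * m j
    + ∑ j, α j * Real.log (Real.cosh (∑ i, (J i j + J j i) / (2 * α j) * m i + h j / α j))

lemma sum_spinAt_eq (N : ℕ) (σ : Fin N → Bool) (s : Finset ℕ) (hs : s ⊆ Finset.range N) :
    ∃ k : ℕ, k ≤ s.card ∧ ∑ i ∈ s, spinAt N i σ = 2 * (k : ℝ) - s.card := by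
  classical
  refine ⟨(s.filter (fun i => spinAt N i σ = 1)).card, Finset.card_filter_le _ _, ?_⟩
  rw [Finset.card_filter, Finset.card_eq_sum_ones]
  push_cast
  rw [Finset.mul_sum, ← Finset.sum_sub_distrib]
  refine Finset.sum_congr rfl fun i hi => ?_
  have hi' : i < N := Finset.mem_range.1 (hs hi)
  simp only [spinAt, hi', dif_pos, spin]
  cases σ ⟨i, hi'⟩ <;> norm_num

lemma sum_exp_spin (N : ℕ) (t : ℕ → ℝ) :
    ∑ σ : Fin N → Bool, Real.exp (∑ i ∈ Finset.range N, t i * spinAt N i σ) =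
      ∏ i ∈ Finset.range N, (2 * Real.cosh (t i)) := by
  classical
  have h1 : ∀ σ : Fin N → Bool, Real.exp (∑ i ∈ Finset.range N, t i * spinAt N i σ) =
      ∏ i : Fin N, Real.exp (t i * spin (σ i)) := by
    intro σ
    rw [Finset.sum_range, Real.exp_sum]
    simp [spinAt]
  simp_rw [h1]
  rw [Finset.prod_range]
  have := (Finset.prod_univ_sum (fun _ : Fin N => (Finset.univ : Finset Bool))
    (fun i b => Real.exp (t i * spin b))).symm
  rw [Fintype.piFinset_univ] at this
  rw [this]
  refine Finset.prod_congr rfl fun i _ => ?_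
  rw [Real.cosh_eq]
  simp [spin]
  ring

/-- The sum over spins of the linearized weight. -/
lemma sum_exp_group {p N : ℕ} (Q : Fin p → Finset ℕ)
    (hdisj : ∀ g k : Fin p, g ≠ k → Disjoint (Q g) (Q k))
    (hcover : Finset.univ.biUnion Q = Finset.range N) (w : Fin p → ℝ) :
    ∑ σ : Fin N → Bool, Real.exp (∑ g, w g * ∑ i ∈ Q g, spinAt N i σ) =
      ∏ g, (2 * Real.cosh (w g)) ^ (Q g).card := by
  classical
  set t : ℕ → ℝ := fun i => ∑ g, if i ∈ Q g then w g else 0 with ht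
  have htg : ∀ g, ∀ i ∈ Q g, t i = w g := by
    intro g i hi
    simp only [ht]
    rw [Finset.sum_eq_single g]
    · simp [hi]
    · intro b _ hb
      rw [if_neg]
      intro hib
      exact (Finset.disjoint_left.1 (hdisj b g hb)) hib hi
    · simp
  have hpd : ((Finset.univ : Finset (Fin p)) : Set (Fin p)).PairwiseDisjoint Q := by
    intro g _ k _ hgk
    exact hdisj g k hgk
  have h1 := sum_exp_spin N t
  rw [← hcover, Finset.prod_biUnion hpd] at h1
  have h2 : ∏ g, ∏ i ∈ Q g, (2 * Real.cosh (t i)) = ∏ g, (2 * Real.cosh (w g)) ^ (Q g).card := by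
    refine Finset.prod_congr rfl fun g _ => ?_
    rw [Finset.prod_congr rfl (fun i hi => by rw [htg g i hi]), Finset.prod_const]
  rw [← h2, ← h1]
  refine Finset.sum_congr rfl fun σ _ => ?_
  rw [Finset.sum_biUnion hpd]
  congr 1
  refine Finset.sum_congr rfl fun g _ => ?_
  rw [Finset.mul_sum]
  exact Finset.sum_congr rfl fun i hi => by rw [htg g i hi]

lemma quad_lin {p : ℕ} (J : Fin p → Fin p → ℝ) (m : Fin p → ℝ) :
    ∑ g, ∑ k, J g k * m g * m k = ∑ j, (∑ i, (J i j + J j i) / 2 * m i) * m j := by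
  have h1 : ∑ g, ∑ k, J g k * m g * m k = ∑ j, ∑ i, J i j * m i * m j := Finset.sum_comm
  have h2 : ∑ j, (∑ i, (J i j + J j i) / 2 * m i) * m j =
      1 / 2 * (∑ j, ∑ i, J i j * m i * m j) + 1 / 2 * (∑ g, ∑ k, J g k * m g * m k) := by
    simp only [Finset.mul_sum, Finset.sum_mul, ← Finset.sum_add_distrib]
    exact Finset.sum_congr rfl fun j _ => Finset.sum_congr rfl fun i _ => by ring
  rw [h2, ← h1]; ring

lemma pressure_le {p : ℕ} (hp : 1 ≤ p) (J : Fin p → Fin p → ℝ) (h : Fin p → ℝ)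
    (P : ℕ → Fin p → Finset ℕ) (N : ℕ) (hN : p ≤ N)
    (hdisj : ∀ g k : Fin p, g ≠ k → Disjoint (P N g) (P N k))
    (hcover : Finset.univ.biUnion (P N) = Finset.range N)
    (hcard : ∀ g, 1 ≤ (P N g).card) (B : ℝ)
    (hB : ∀ m ∈ Set.univ.pi fun _ : Fin p => Set.Icc (-1 : ℝ) 1,
      pUP (fun g => ((P N g).card : ℝ) / N) J h m ≤ B) :
    pressurePair J h P N ≤ p * (Real.log (N + 1) / N) + B := by
  classical
  have hN0 : (0 : ℝ) < N := by exact_mod_cast (by omega : 0 < N)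
  have hn0 : ∀ g, (0 : ℝ) < ((P N g).card : ℝ) := fun g => by exact_mod_cast hcard g
  have hsub : ∀ g, P N g ⊆ Finset.range N := fun g => by
    rw [← hcover]; exact Finset.subset_biUnion_of_mem _ (Finset.mem_univ g)
  have hsumcard : ∑ g, ((P N g).card : ℝ) = N := by
    have := Finset.card_biUnion (s := Finset.univ) (t := P N) (fun g _ k _ hgk => hdisj g k hgk)
    rw [hcover, Finset.card_range] at this
    exact_mod_cast this.symm
  set M : (Fin N → Bool) → Fin p → ℝ := fun σ g => groupMag P N g σ with hM
  set S : Finset (Fin p → ℝ) := Finset.univ.image M with hS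
  have hMk : ∀ σ g, ∃ k : ℕ, k ≤ (P N g).card ∧
      M σ g = (2 * (k : ℝ) - (P N g).card) / (P N g).card := by
    intro σ g
    obtain ⟨k, hk, hk2⟩ := sum_spinAt_eq N σ (P N g) (hsub g)
    exact ⟨k, hk, by simp only [hM, groupMag, hk2]⟩
  have hSK : ∀ m ∈ S, m ∈ Set.univ.pi fun _ : Fin p => Set.Icc (-1 : ℝ) 1 := by
    intro m hm
    obtain ⟨σ, -, rfl⟩ := Finset.mem_image.1 hm
    intro g _
    obtain ⟨k, hk, hk2⟩ := hMk σ g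
    have hk' : (k : ℝ) ≤ (P N g).card := by exact_mod_cast hk
    have hk0 : (0 : ℝ) ≤ k := Nat.cast_nonneg k
    rw [hk2]
    constructor
    · rw [le_div_iff₀ (hn0 g)]; linarith
    · rw [div_le_iff₀ (hn0 g)]; linarith
  have hScard : S.card ≤ (N + 1) ^ p := by
    have hss : S ⊆ Fintype.piFinset (fun g : Fin p => (Finset.range (N + 1)).image
        (fun k : ℕ => (2 * (k : ℝ) - (P N g).card) / (P N g).card)) := by
      intro m hm
      obtain ⟨σ, -, rfl⟩ := Finset.mem_image.1 hm
      rw [Fintype.mem_piFinset]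
      intro g
      obtain ⟨k, hk, hk2⟩ := hMk σ g
      refine Finset.mem_image.2 ⟨k, ?_, hk2.symm⟩
      have := Finset.card_le_card (hsub g)
      rw [Finset.card_range] at this
      exact Finset.mem_range.2 (by omega)
    refine (Finset.card_le_card hss).trans ?_
    rw [Fintype.card_piFinset]
    refine (Finset.prod_le_pow_card _ _ (N + 1) fun g _ => ?_).trans (by simp)
    exact Finset.card_image_le.trans (by simp)
  set w : (Fin p → ℝ) → Fin p → ℝ := fun m j =>
    ∑ i, (J i j + J j i) / (2 * (((P N j).card : ℝ) / N)) * m i + h j / (((P N j).card : ℝ) / N)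
    with hw
  set F : (Fin p → ℝ) → (Fin N → Bool) → ℝ := fun m σ =>
    Real.exp (-(N * (1 / 2 * ∑ i, ∑ j, J i j * m i * m j)) +
      ∑ g, w m g * ∑ i ∈ P N g, spinAt N i σ) with hF
  have hdiag : ∀ σ, Real.exp (-hamPair J h P N σ) = F (M σ) σ := by
    intro σ
    simp only [hF, hamPair]
    congr 1
    have e1 : ∑ g, w (M σ) g * ∑ i ∈ P N g, spinAt N i σ =
        N * (∑ j, (∑ i, (J i j + J j i) / 2 * M σ i) * M σ j + ∑ g, h g * M σ g) := by
      rw [← Finset.sum_add_distrib, Finset.mul_sum]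
      refine Finset.sum_congr rfl fun g _ => ?_
      have hs : ∑ i ∈ P N g, spinAt N i σ = (P N g).card * M σ g := by
        simp only [hM, groupMag]
        field_simp [(hn0 g).ne']
      have hww : w (M σ) g = N / (P N g).card * (∑ i, (J i g + J g i) / 2 * M σ i + h g) := by
        simp only [hw]
        rw [mul_add, Finset.mul_sum]
        have := (hn0 g).ne'
        congr 1
        · refine Finset.sum_congr rfl fun i _ => ?_
          field_simp
        · field_simp
      rw [hs, hww]
      have := (hn0 g).ne'
      field_simp
    rw [e1, ← quad_lin]
    simp only [hM]
    ring
  have hFsum : ∀ m, ∑ σ, F m σ =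
      Real.exp (N * pUP (fun g => ((P N g).card : ℝ) / N) J h m) := by
    intro m
    simp only [hF, Real.exp_add]
    rw [← Finset.mul_sum, sum_exp_group (P N) hdisj hcover (w m)]
    have hc : ∀ g, (0 : ℝ) < Real.cosh (w m g) := fun g => Real.cosh_pos _
    have e2 : ∏ g, (2 * Real.cosh (w m g)) ^ (P N g).card =
        Real.exp (∑ g, ((P N g).card : ℝ) * (Real.log 2 + Real.log (Real.cosh (w m g)))) := by
      rw [Real.exp_sum]
      refine Finset.prod_congr rfl fun g _ => ?_
      rw [← Real.log_mul two_ne_zero (hc g).ne', Real.exp_nat_mul,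
        Real.exp_log (mul_pos two_pos (hc g))]
    rw [e2, ← Real.exp_add]
    congr 1
    simp only [pUP, mul_add, Finset.sum_add_distrib]
    rw [← Finset.sum_mul, hsumcard]
    have e3 : (N : ℝ) * ∑ j, ((P N j).card : ℝ) / N * Real.log (Real.cosh (w m j)) =
        ∑ g, ((P N g).card : ℝ) * Real.log (Real.cosh (w m g)) := by
      rw [Finset.mul_sum]
      refine Finset.sum_congr rfl fun g _ => ?_
      field_simp
    rw [← e3]
    simp only [hw]
    ring
  have hZ : ∑ σ : Fin N → Bool, Real.exp (-hamPair J h P N σ) ≤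
      ((N : ℝ) + 1) ^ p * Real.exp (N * B) := by
    calc ∑ σ : Fin N → Bool, Real.exp (-hamPair J h P N σ)
        = ∑ σ, F (M σ) σ := Finset.sum_congr rfl fun σ _ => hdiag σ
      _ ≤ ∑ σ, ∑ m ∈ S, F m σ := by
          refine Finset.sum_le_sum fun σ _ => ?_
          exact Finset.single_le_sum (f := fun m => F m σ) (fun m _ => (Real.exp_pos _).le)
            (Finset.mem_image_of_mem M (Finset.mem_univ σ))
      _ = ∑ m ∈ S, ∑ σ, F m σ := Finset.sum_comm
      _ ≤ ∑ m ∈ S, Real.exp (N * B) := by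
          refine Finset.sum_le_sum fun m hm => ?_
          rw [hFsum]
          exact Real.exp_le_exp.2 (mul_le_mul_of_nonneg_left (hB m (hSK m hm)) hN0.le)
      _ = S.card * Real.exp (N * B) := by rw [Finset.sum_const, nsmul_eq_mul]
      _ ≤ ((N : ℝ) + 1) ^ p * Real.exp (N * B) := by
          refine mul_le_mul_of_nonneg_right ?_ (Real.exp_pos _).le
          exact_mod_cast hScard
  have hZpos : 0 < ∑ σ : Fin N → Bool, Real.exp (-hamPair J h P N σ) :=
    Finset.sum_pos (fun _ _ => Real.exp_pos _) Finset.univ_nonempty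
  have hlog := Real.log_le_log hZpos hZ
  rw [Real.log_mul (by positivity) (Real.exp_pos _).ne', Real.log_exp, Real.log_pow] at hlog
  rw [pressurePair, div_le_iff₀ hN0]
  refine hlog.trans (le_of_eq ?_)
  field_simp

lemma le_pressure {p : ℕ} (hp : 1 ≤ p) (J : Fin p → Fin p → ℝ) (h : Fin p → ℝ)
    (P : ℕ → Fin p → Finset ℕ) (N : ℕ) (hN : p ≤ N)
    (hcover : Finset.univ.biUnion (P N) = Finset.range N)
    (hcard : ∀ g, 1 ≤ (P N g).card) :
    1 / 2 * ∑ g, ∑ k, J g k + ∑ g, h g ≤ pressurePair J h P N := by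
  have hN0 : (0 : ℝ) < N := by exact_mod_cast (by omega : 0 < N)
  have hsub : ∀ g, P N g ⊆ Finset.range N := fun g => by
    rw [← hcover]; exact Finset.subset_biUnion_of_mem _ (Finset.mem_univ g)
  have hm : ∀ g, groupMag P N g (fun _ => true) = 1 := by
    intro g
    have hn0 : ((P N g).card : ℝ) ≠ 0 := by
      have := hcard g
      exact_mod_cast (by omega : (P N g).card ≠ 0)
    rw [groupMag, Finset.sum_congr rfl (g := fun _ => (1 : ℝ))]
    · simp [hn0]
    · intro i hi
      have hi' : i < N := Finset.mem_range.1 (hsub g hi)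
      simp [spinAt, hi', spin]
  have h1 : Real.exp (-hamPair J h P N (fun _ => true)) ≤
      ∑ σ : Fin N → Bool, Real.exp (-hamPair J h P N σ) :=
    Finset.single_le_sum (f := fun σ => Real.exp (-hamPair J h P N σ))
      (fun m _ => (Real.exp_pos _).le) (Finset.mem_univ _)
  have h2 := Real.log_le_log (Real.exp_pos _) h1
  rw [Real.log_exp] at h2
  rw [pressurePair, le_div_iff₀ hN0]
  refine le_trans (le_of_eq ?_) h2
  simp only [hamPair, hm]
  simp
  ring

lemma pUP_continuousAt {p : ℕ} (α : Fin p → ℝ) (hα : ∀ g, α g ≠ 0)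
    (J : Fin p → Fin p → ℝ) (h : Fin p → ℝ) (m : Fin p → ℝ) :
    ContinuousAt (fun z : (Fin p → ℝ) × (Fin p → ℝ) => pUP z.1 J h z.2) (α, m) := by
  unfold pUP
  have hc : ∀ j : Fin p, ContinuousAt (fun z : (Fin p → ℝ) × (Fin p → ℝ) => z.1 j) (α, m) :=
    fun j => by fun_prop
  have hd : ∀ j : Fin p, ContinuousAt (fun z : (Fin p → ℝ) × (Fin p → ℝ) => z.2 j) (α, m) :=
    fun j => by fun_prop
  refine ContinuousAt.add (by fun_prop) ?_
  refine tendsto_finsetSum _ fun j _ => ?_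
  refine ContinuousAt.mul (hc j) ?_
  refine ContinuousAt.log ?_ (Real.cosh_pos _).ne'
  refine Real.continuous_cosh.continuousAt.comp ?_
  refine ContinuousAt.add ?_ (continuousAt_const.div (hc j) (hα j))
  refine tendsto_finsetSum _ fun i _ => ?_
  refine ContinuousAt.mul ?_ (hd i)
  exact continuousAt_const.div (continuousAt_const.mul (hc j)) (mul_ne_zero two_ne_zero (hα j))

/-- Upper bound for the multi-population pressure:
`limsup_{N→∞} p_N ≤ sup_{m̄ ∈ [−1,1]^p} p_UP(m̄)`. -/
theorem multiPopulation_pressure_upper_bound (p : ℕ) (hp : 1 ≤ p)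
    (α : Fin p → ℝ) (hα : ∀ g, α g ∈ Set.Ioo (0 : ℝ) 1) (hαsum : ∑ g, α g = 1)
    (J : Fin p → Fin p → ℝ) (h : Fin p → ℝ)
    (P : ℕ → Fin p → Finset ℕ)
    (hdisj : ∀ N, ∀ g k : Fin p, g ≠ k → Disjoint (P N g) (P N k))
    (hcover : ∀ N, p ≤ N → Finset.univ.biUnion (P N) = Finset.range N)
    (hcard : ∀ N, p ≤ N → ∀ g, 1 ≤ (P N g).card)
    (hfrac : ∀ g, Tendsto (fun N : ℕ => ((P N g).card : ℝ) / N) atTop (nhds (α g))) :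
    limsup (fun N : ℕ => pressurePair J h P N) atTop ≤
      sSup (pUP α J h '' Set.univ.pi fun _ : Fin p => Set.Icc (-1 : ℝ) 1) := by
  have hα0 : ∀ g, α g ≠ 0 := fun g => (hα g).1.ne'
  set K : Set (Fin p → ℝ) := Set.univ.pi fun _ : Fin p => Set.Icc (-1 : ℝ) 1 with hK
  have hKc : IsCompact K := isCompact_univ_pi fun _ => isCompact_Icc
  have hcont : ContinuousOn (pUP α J h) K := by
    intro m _
    have h1 := pUP_continuousAt α hα0 J h m
    have h2 : ContinuousAt (fun m : Fin p → ℝ => (α, m)) m := by fun_prop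
    exact (ContinuousAt.comp (f := fun m : Fin p → ℝ => (α, m)) h1 h2).continuousWithinAt
  have hbdd : BddAbove (pUP α J h '' K) := (hKc.image_of_continuousOn hcont).bddAbove
  set B := sSup (pUP α J h '' K) with hBdef
  have hlow : ∀ᶠ N : ℕ in atTop,
      1 / 2 * ∑ g, ∑ k, J g k + ∑ g, h g ≤ pressurePair J h P N := by
    filter_upwards [eventually_ge_atTop p] with N hN
    exact le_pressure hp J h P N hN (hcover N hN) (hcard N hN)
  have hcob : IsCoboundedUnder (· ≤ ·) atTop (fun N : ℕ => pressurePair J h P N) :=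
    IsBoundedUnder.isCoboundedUnder_le ⟨_, eventually_map.2 hlow⟩
  refine le_of_forall_pos_le_add fun ε hε => ?_
  refine limsup_le_of_le hcob ?_
  have hev : ∀ᶠ a in nhds α, ∀ m ∈ K, pUP a J h m ≤ B + ε / 2 := by
    refine hKc.eventually_forall_of_forall_eventually fun m hm => ?_
    have hlt : pUP α J h m < B + ε / 2 := by
      have := le_csSup hbdd (Set.mem_image_of_mem (pUP α J h) hm)
      linarith
    exact ((pUP_continuousAt α hα0 J h m).eventually_lt_const hlt).mono fun z hz => le_of_lt hz
  have hfr : Tendsto (fun N : ℕ => fun g => ((P N g).card : ℝ) / N) atTop (nhds α) :=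
    tendsto_pi_nhds.2 hfrac
  have hlog : Tendsto (fun N : ℕ => (p : ℝ) * (Real.log ((N : ℝ) + 1) / N)) atTop (nhds 0) := by
    have h1 : Tendsto (fun x : ℝ => Real.log x / (1 * x + (-1))) atTop (nhds 0) := by
      simpa using Real.tendsto_pow_log_div_mul_add_atTop 1 (-1) 1 one_ne_zero
    have h2 : Tendsto (fun N : ℕ => (N : ℝ) + 1) atTop atTop :=
      tendsto_atTop_add_const_right _ _ tendsto_natCast_atTop_atTop
    have h3 := (h1.comp h2).const_mul (p : ℝ)
    simpa [Function.comp_def] using h3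
  filter_upwards [eventually_ge_atTop p, hfr.eventually hev,
    hlog.eventually_lt_const (half_pos hε)] with N hN hN2 hN3
  have := pressure_le hp J h P N hN (hdisj N) (hcover N hN) (hcard N hN) _ hN2
  linarith
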